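/- arXiv:2508.20855 — 6 statements merged into one kernel-verified Lean document; each statement's English description precedes it below -/
import Mathlib

section
/- Let T ≥ 2, let G_T = Δ_T(1,2,-1), H_T = Δ_T(0,-2,1), A_T = Δ_T(−(T−1)/2, −(T−2)/3, (T+1)/6), and let F_T be the T×T matrix whose first column is (T, T−1, …, 2, 1)′ and whose other columns are zero. Then G_T⁻¹H_T = F_T − I_T and −6·G_T⁻¹A_T = 2(T+1)·F_T − 6·G_T⁻¹ + (T+1)·I_T. -/
open Matrix
open scoped Matrix Kronecker

noncomputable section

/-- `tri n a b c` is the n×n tridiagonal matrix with (1,1) entry `a`, all other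
diagonal entries `b`, all super- and sub-diagonal entries `c`, and zeros elsewhere. -/
def tri (n : ℕ) (a b c : ℝ) : Matrix (Fin n) (Fin n) ℝ :=
  Matrix.of fun i j =>
    if (i : ℕ) = (j : ℕ) then (if (i : ℕ) = 0 then a else b)
    else if (i : ℕ) + 1 = (j : ℕ) ∨ (j : ℕ) + 1 = (i : ℕ) then c else 0


/-- F_T : T×T matrix with first column (T, T−1, …, 1)′ and zeros elsewhere. -/
def FMat (T : ℕ) : Matrix (Fin T) (Fin T) ℝ :=
  Matrix.of fun i j => if (j : ℕ) = 0 then (T : ℝ) - (i : ℕ) else 0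

/-- Rows of Δ_T(1,2,-1) act on a sequence vanishing at `T` as a negated second difference,
with a reflecting boundary at `0`. -/
lemma sum_tri_one_two_neg_one_mul {T : ℕ} (f : ℕ → ℝ) (hf : f T = 0) (i : Fin T) :
    ∑ k : Fin T, tri T 1 2 (-1) i k * f k =
      (if (i : ℕ) = 0 then f 0 else 2 * f i - f (i - 1)) - f (i + 1) := by
  obtain ⟨i, hi⟩ := i
  let g : ℕ → ℝ := fun k => (if k = i then (if i = 0 then f 0 else 2 * f i) else 0)
    + (if k = i + 1 then -f (i + 1) else 0)
    + (if k = i - 1 then (if i = 0 then 0 else -f (i - 1)) else 0)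
  have key : ∀ k : Fin T, tri T 1 2 (-1) ⟨i, hi⟩ k * f k = g k := by
    rintro ⟨k, hk⟩
    simp only [tri, Matrix.of_apply, g]
    grind
  rw [Finset.sum_congr rfl fun k _ => key k, Fin.sum_univ_eq_sum_range g]
  simp only [g, Finset.sum_add_distrib, Finset.sum_ite_eq', Finset.mem_range]
  have hT : i + 1 < T ∨ i + 1 = T := by omega
  grind

lemma isUnit_det_tri_one_two_neg_one (T : ℕ) : IsUnit (tri T 1 2 (-1)).det := by
  refine Matrix.isUnit_det_of_right_inverse
    (B := Matrix.of fun i j : Fin T => (T : ℝ) - ((max (i : ℕ) (j : ℕ) : ℕ) : ℝ)) ?_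
  ext i j
  have h := sum_tri_one_two_neg_one_mul
    (fun k => (T : ℝ) - ((max k (j : ℕ) : ℕ) : ℝ)) (by simp) i
  rw [Matrix.mul_apply]
  simp only [Matrix.of_apply]
  rw [h, Matrix.one_apply]
  obtain ⟨i, hi⟩ := i
  obtain ⟨j, hj⟩ := j
  simp only [Fin.mk.injEq]
  rcases lt_trichotomy i j with hij | rfl | hij
  · have h1 : max i j = j := by omega
    have h2 : max (i - 1) j = j := by omega
    have h3 : max (i + 1) j = j := by omega
    have h4 : max 0 j = j := by omega
    rw [h1, h2, h3, h4, if_neg hij.ne]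
    split_ifs <;> ring
  · have h2 : max (i - 1) i = i := by omega
    have h3 : max (i + 1) i = i + 1 := by omega
    have h4 : max 0 i = i := by omega
    rw [max_self, h2, h3, h4, if_pos rfl]
    push_cast
    split_ifs <;> ring
  · obtain ⟨i, rfl⟩ : ∃ m, i = m + 1 := ⟨i - 1, by omega⟩
    have h1 : max (i + 1) j = i + 1 := by omega
    have h2 : max (i + 1 - 1) j = i := by omega
    have h3 : max (i + 1 + 1) j = i + 1 + 1 := by omega
    rw [h1, h2, h3, if_neg hij.ne', if_neg i.succ_ne_zero]
    push_cast
    ring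

lemma tri_one_two_neg_one_mul_FMat (T : ℕ) :
    tri T 1 2 (-1) * FMat T =
      Matrix.of fun i j : Fin T => if (i : ℕ) = 0 ∧ (j : ℕ) = 0 then (1 : ℝ) else 0 := by
  ext i j
  rw [Matrix.mul_apply]
  simp only [FMat, Matrix.of_apply]
  by_cases hj : (j : ℕ) = 0
  · simp only [hj, if_true, and_true]
    rw [sum_tri_one_two_neg_one_mul (fun k => (T : ℝ) - k) (sub_self _) i]
    obtain ⟨_ | i, hi⟩ := i
    · simp
    · simp
      ring
  · simp [hj]

/-- For T ≥ 2, with G_T = Δ_T(1,2,-1), H_T = Δ_T(0,-2,1) and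
A_T = Δ_T(−(T−1)/2, −(T−2)/3, (T+1)/6), one has G_T⁻¹H_T = F_T − I and
−6·G_T⁻¹A_T = 2(T+1)·F_T − 6·G_T⁻¹ + (T+1)·I. -/
theorem stmt_2 (T : ℕ) (hT : 2 ≤ T) :
    (tri T 1 2 (-1))⁻¹ * tri T 0 (-2) 1 = FMat T - 1 ∧
      (-6 : ℝ) • ((tri T 1 2 (-1))⁻¹ *
          tri T (-(((T : ℝ) - 1) / 2)) (-(((T : ℝ) - 2) / 3)) (((T : ℝ) + 1) / 6)) =
        (2 * ((T : ℝ) + 1)) • FMat T - (6 : ℝ) • (tri T 1 2 (-1))⁻¹ +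
          ((T : ℝ) + 1) • (1 : Matrix (Fin T) (Fin T) ℝ) := by
  have hG := isUnit_det_tri_one_two_neg_one T
  have hF := tri_one_two_neg_one_mul_FMat T
  have hH : tri T 0 (-2) 1 = tri T 1 2 (-1) * (FMat T - 1) := by
    rw [mul_sub, mul_one, hF]
    ext i j
    simp only [tri, Matrix.sub_apply, Matrix.of_apply]
    grind
  have hA : (-6 : ℝ) •
      tri T (-(((T : ℝ) - 1) / 2)) (-(((T : ℝ) - 2) / 3)) (((T : ℝ) + 1) / 6) =
      tri T 1 2 (-1) * ((2 * ((T : ℝ) + 1)) • FMat T - (6 : ℝ) • (tri T 1 2 (-1))⁻¹ +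
        ((T : ℝ) + 1) • (1 : Matrix (Fin T) (Fin T) ℝ)) := by
    rw [mul_add, mul_sub, Matrix.mul_smul, Matrix.mul_smul, Matrix.mul_smul, mul_one, hF,
      Matrix.mul_nonsing_inv _ hG]
    ext i j
    simp only [tri, Matrix.sub_apply, Matrix.add_apply, Matrix.smul_apply, Matrix.of_apply,
      Matrix.one_apply, smul_eq_mul, Fin.ext_iff]
    grind
  constructor
  · rw [hH, Matrix.nonsing_inv_mul_cancel_left _ _ hG]
  · rw [← Matrix.mul_smul, hA, Matrix.nonsing_inv_mul_cancel_left _ _ hG]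
end
end

section
/- Let T ≥ 2. With A_T = Δ_T(−(T−1)/2, −(T−2)/3, (T+1)/6), G_T = Δ_T(1,2,-1), p_T = T(T+1)/2 − 2, g_T the p_T-vector defined by vech(G_T) = (1, −1, g_T′)′, P_T the p_T × T(T+1)/2 matrix P_T = (0 | g_T | I_{p_T}) (first column zero, second column g_T, remaining columns the identity), Z_T the 2 × T(T+1)/2 matrix with rows (1, 0, 0, …, 0) and (0, 1, −g_T′), M_T = 2·D⁺_{u,T}(G_T ⊗ G_T)(D⁺_{u,T})′, and P̄_T the T(T+1)/2 × T(T+1)/2 matrix obtained by stacking Z_T·M_T⁻¹ on top of P_T, one has P̄_T·vech(A_T) = vech(I_T) − e₁, where e₁ is the first standard basis vector of ℝ^{T(T+1)/2}. -/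
open Matrix
open scoped Matrix Kronecker

noncomputable section

/-- Index set for `vech`: pairs (column j, row i) with j ≤ i, i.e. on-and-below-diagonal
positions, the order of the stacking being column-major. -/
abbrev VechIdx (T : ℕ) : Type := {p : Fin T × Fin T // (p.1 : ℕ) ≤ (p.2 : ℕ)}

/-- column-major vec: `vecM A (j, i) = A i j`. -/
def vecM {T : ℕ} (A : Matrix (Fin T) (Fin T) ℝ) : Fin T × Fin T → ℝ :=
  fun p => A p.2 p.1

/-- half-vectorization: entries on and below the diagonal, column by column. -/
def vechM {T : ℕ} (A : Matrix (Fin T) (Fin T) ℝ) : VechIdx T → ℝ :=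
  fun q => A q.val.2 q.val.1

/-- the duplication matrix: the unique matrix with `vecM A = dup T *ᵥ vechM A`
for every symmetric T×T matrix A. -/
def dup (T : ℕ) : Matrix (Fin T × Fin T) (VechIdx T) ℝ :=
  Matrix.of fun p q =>
    if (p.1 = q.val.1 ∧ p.2 = q.val.2) ∨ (p.1 = q.val.2 ∧ p.2 = q.val.1) then 1 else 0

/-- Moore–Penrose inverse of the duplication matrix. -/
def dupPlus (T : ℕ) : Matrix (VechIdx T) (Fin T × Fin T) ℝ :=
  ((dup T)ᵀ * dup T)⁻¹ * (dup T)ᵀ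

/-- M_T = 2 D⁺ (G ⊗ G) D⁺′ with G the tridiagonal Δ_T(1,2,-1). -/
def MMat (T : ℕ) : Matrix (VechIdx T) (VechIdx T) ℝ :=
  (2 : ℝ) • (dupPlus T * (tri T 1 2 (-1) ⊗ₖ tri T 1 2 (-1)) * (dupPlus T)ᵀ)

/-- Index set of the "remaining" vech entries (all but the first two in column-major order). -/
abbrev RIdx (T : ℕ) : Type :=
  {q : VechIdx T // ¬((q.val.1 : ℕ) = 0 ∧ (q.val.2 : ℕ) = 0) ∧
                   ¬((q.val.1 : ℕ) = 0 ∧ (q.val.2 : ℕ) = 1)}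

/-- g_T : the vector with vech(G_T) = (1, −1, g_T′)′. -/
def gVec (T : ℕ) : RIdx T → ℝ := fun q => vechM (tri T 1 2 (-1)) q.val

/-- P_T = (0 | g_T | I_{p_T}). -/
def PMat (T : ℕ) : Matrix (RIdx T) (VechIdx T) ℝ :=
  Matrix.of fun r c =>
    if (c.val.1 : ℕ) = 0 ∧ (c.val.2 : ℕ) = 0 then 0
    else if (c.val.1 : ℕ) = 0 ∧ (c.val.2 : ℕ) = 1 then gVec T r
    else if c = r.val then 1 else 0

/-- Z_T : 2 × T(T+1)/2 matrix with rows (1,0,0,…,0) and (0,1,−g_T′). -/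
def ZMat (T : ℕ) : Matrix (Fin 2) (VechIdx T) ℝ :=
  Matrix.of fun i c =>
    if (i : ℕ) = 0 then
      (if (c.val.1 : ℕ) = 0 ∧ (c.val.2 : ℕ) = 0 then 1 else 0)
    else
      (if (c.val.1 : ℕ) = 0 ∧ (c.val.2 : ℕ) = 0 then 0
       else if (c.val.1 : ℕ) = 0 ∧ (c.val.2 : ℕ) = 1 then 1
       else -(vechM (tri T 1 2 (-1)) c))

/-- A_T = Δ_T(−(T−1)/2, −(T−2)/3, (T+1)/6). -/
def AMat (T : ℕ) : Matrix (Fin T) (Fin T) ℝ :=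
  tri T (-(((T : ℝ) - 1) / 2)) (-(((T : ℝ) - 2) / 3)) (((T : ℝ) + 1) / 6)

lemma sum_tri_mul {T : ℕ} (a b c : ℝ) (f : ℕ → ℝ) (hf : f T = 0) (i : Fin T) :
    ∑ j : Fin T, tri T a b c i j * f j =
      (if (i : ℕ) = 0 then a * f 0 else b * f i + c * f (i - 1)) + c * f (i + 1) := by
  have hi := i.isLt
  have key : ∀ j : ℕ,
      (if (i : ℕ) = j then (if (i : ℕ) = 0 then a else b)
        else if (i : ℕ) + 1 = j ∨ j + 1 = (i : ℕ) then c else 0) * f j =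
      (if (i : ℕ) = j then (if (i : ℕ) = 0 then a else b) * f j else 0) +
      (if (i : ℕ) + 1 = j then c * f j else 0) +
      (if (i : ℕ) - 1 = j then (if (i : ℕ) = 0 then 0 else c * f j) else 0) := by
    intro j
    split_ifs <;> first | omega | simp
  have hsum := Fin.sum_univ_eq_sum_range (fun j : ℕ =>
      (if (i : ℕ) = j then (if (i : ℕ) = 0 then a else b)
        else if (i : ℕ) + 1 = j ∨ j + 1 = (i : ℕ) then c else 0) * f j) T
  simp only [tri, Matrix.of_apply]
  have hsucc := Finset.sum_range_succ (fun j : ℕ =>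
      (if (i : ℕ) = j then (if (i : ℕ) = 0 then a else b)
        else if (i : ℕ) + 1 = j ∨ j + 1 = (i : ℕ) then c else 0) * f j) T
  rw [hf, mul_zero, add_zero] at hsucc
  rw [hsum, ← hsucc, Finset.sum_congr rfl fun j _ => key j]
  simp only [Finset.sum_add_distrib, Finset.sum_ite_eq, Finset.mem_range]
  rw [if_pos (show (i : ℕ) < T + 1 by omega), if_pos (show (i : ℕ) + 1 < T + 1 by omega),
    if_pos (show (i : ℕ) - 1 < T + 1 by omega)]
  split_ifs with h
  · simp [h]
  · ring

lemma tri_isSymm (T : ℕ) (a b c : ℝ) : (tri T a b c)ᵀ = tri T a b c := by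
  ext i j
  simp only [tri, Matrix.transpose_apply, Matrix.of_apply]
  split_ifs <;> first | rfl | omega

/-- The inverse of `Δ_T(1, 2, -1)`. -/
def triInv (T : ℕ) : Matrix (Fin T) (Fin T) ℝ :=
  Matrix.of fun i j => (T : ℝ) - ((max (i : ℕ) (j : ℕ) : ℕ) : ℝ)

lemma triInv_transpose (T : ℕ) : (triInv T)ᵀ = triInv T := by
  ext i j
  simp [triInv, max_comm]

lemma tri_mul_triInv (T : ℕ) : tri T 1 2 (-1) * triInv T = 1 := by
  ext i k
  have hi := i.isLt
  have hk := k.isLt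
  rw [Matrix.mul_apply]
  simp only [triInv, Matrix.of_apply]
  rw [sum_tri_mul 1 2 (-1) (fun j => (T : ℝ) - ((max j (k : ℕ) : ℕ) : ℝ))
    (by simp)]
  rw [Matrix.one_apply]
  simp only [Fin.ext_iff]
  rcases lt_trichotomy (i : ℕ) (k : ℕ) with h | h | h
  · rw [if_neg h.ne, max_eq_right h.le, max_eq_right (show (i : ℕ) + 1 ≤ k by omega),
      max_eq_right (show (i : ℕ) - 1 ≤ k by omega), max_eq_right (Nat.zero_le _)]
    split_ifs <;> ring
  · rw [if_pos h, max_eq_right h.le, max_eq_left (show (k : ℕ) ≤ i + 1 by omega),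
      max_eq_right (show (i : ℕ) - 1 ≤ k by omega), max_eq_right (Nat.zero_le _), h]
    split_ifs <;> push_cast <;> ring
  · rw [if_neg h.ne', max_eq_left h.le, max_eq_left (show (k : ℕ) ≤ i + 1 by omega),
      max_eq_left (show (k : ℕ) ≤ i - 1 by omega), if_neg (by omega)]
    push_cast [Nat.cast_sub (show 1 ≤ (i : ℕ) by omega)]
    ring

/-- The on-or-below-diagonal position that carries the same entry of a symmetric matrix. -/
def vechPos {T : ℕ} (p : Fin T × Fin T) : VechIdx T :=
  if h : (p.1 : ℕ) ≤ (p.2 : ℕ) then ⟨p, h⟩ else ⟨p.swap, (not_le.mp h).le⟩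

lemma dup_apply {T : ℕ} (p : Fin T × Fin T) (q : VechIdx T) :
    dup T p q = if vechPos p = q then 1 else 0 := by
  obtain ⟨⟨a, b⟩, hq⟩ := q
  obtain ⟨c, d⟩ := p
  simp only [dup, Matrix.of_apply, vechPos]
  have hq' : (a : ℕ) ≤ b := hq
  refine if_congr ?_ rfl rfl
  split_ifs with h <;> simp only [Subtype.mk.injEq, Prod.mk.injEq, Prod.swap_prod_mk,
    Fin.ext_iff] at h ⊢ <;> omega

lemma vechPos_val {T : ℕ} (q : VechIdx T) : vechPos q.val = q := by
  simp [vechPos, q.property]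

lemma vechPos_swap {T : ℕ} (p : Fin T × Fin T) : vechPos p.swap = vechPos p := by
  obtain ⟨c, d⟩ := p
  simp only [vechPos, Prod.swap_prod_mk]
  split_ifs <;> simp only [Subtype.mk.injEq, Prod.mk.injEq, Fin.ext_iff] <;> omega

lemma dup_mulVec {T : ℕ} (v : VechIdx T → ℝ) (p : Fin T × Fin T) :
    (dup T *ᵥ v) p = v (vechPos p) := by
  simp [Matrix.mulVec, dotProduct, dup_apply]

lemma dup_mulVec_vechM {T : ℕ} (A : Matrix (Fin T) (Fin T) ℝ) (hA : Aᵀ = A) :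
    dup T *ᵥ vechM A = Matrix.vec A := by
  ext p
  rw [dup_mulVec]
  simp only [vechM, vechPos, Matrix.vec]
  split_ifs with h
  · rfl
  · exact congrFun (congrFun hA p.2) p.1

lemma isUnit_dup_transpose_mul_dup (T : ℕ) : IsUnit ((dup T)ᵀ * dup T) := by
  have hinj : Function.Injective (dup T).mulVec := by
    intro v w h
    ext q
    have := congrFun h q.val
    simpa only [dup_mulVec, vechPos_val] using this
  simpa using (Matrix.PosDef.conjTranspose_mul_self (dup T) hinj).isUnit

lemma dupPlus_mul_dup (T : ℕ) : dupPlus T * dup T = 1 := by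
  rw [dupPlus, Matrix.mul_assoc, Matrix.nonsing_inv_mul]
  exact (Matrix.isUnit_iff_isUnit_det _).mp (isUnit_dup_transpose_mul_dup T)

lemma transpose_dup_mul_dupPlus (T : ℕ) : (dup T * dupPlus T)ᵀ = dup T * dupPlus T := by
  simp only [dupPlus, Matrix.transpose_mul, Matrix.transpose_nonsing_inv,
    Matrix.transpose_transpose, Matrix.mul_assoc]

lemma exists_kronecker_mul_dup {T : ℕ} (B : Matrix (Fin T) (Fin T) ℝ) :
    ∃ W : Matrix (VechIdx T) (VechIdx T) ℝ, (B ⊗ₖ B) * dup T = dup T * W := by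
  refine ⟨Matrix.of fun q r => ((B ⊗ₖ B) * dup T) q.val r, ?_⟩
  have hswap : ∀ p r, ((B ⊗ₖ B) * dup T) p.swap r = ((B ⊗ₖ B) * dup T) p r := by
    intro p r
    simp only [Matrix.mul_apply]
    refine Fintype.sum_equiv (Equiv.prodComm _ _) _ _ fun x => ?_
    obtain ⟨p₁, p₂⟩ := p
    obtain ⟨x₁, x₂⟩ := x
    simp only [Equiv.prodComm_apply, dup_apply, vechPos_swap]
    simp only [Matrix.kronecker_apply, Prod.swap_prod_mk]
    ring
  ext p r
  rw [Matrix.mul_apply (M := dup T)]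
  simp only [dup_apply, Matrix.of_apply, ite_mul, one_mul, zero_mul, Finset.sum_ite_eq,
    Finset.mem_univ, if_true]
  unfold vechPos
  split_ifs
  · rfl
  · exact (hswap p r).symm

lemma MMat_inv (T : ℕ) :
    (MMat T)⁻¹ = (1 / 2 : ℝ) • ((dup T)ᵀ * (triInv T ⊗ₖ triInv T) * dup T) := by
  apply Matrix.inv_eq_right_inv
  obtain ⟨W, hW⟩ := exists_kronecker_mul_dup (triInv T)
  have hproj : (dupPlus T)ᵀ * (dup T)ᵀ * ((triInv T ⊗ₖ triInv T) * dup T) =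
      (triInv T ⊗ₖ triInv T) * dup T := by
    rw [← Matrix.transpose_mul, transpose_dup_mul_dupPlus, hW, Matrix.mul_assoc,
      ← Matrix.mul_assoc (dupPlus T), dupPlus_mul_dup, Matrix.one_mul]
  rw [MMat, Matrix.smul_mul, Matrix.mul_smul, smul_smul]
  norm_num
  calc dupPlus T * (tri T 1 2 (-1) ⊗ₖ tri T 1 2 (-1)) * (dupPlus T)ᵀ *
        ((dup T)ᵀ * (triInv T ⊗ₖ triInv T) * dup T)
      = dupPlus T * ((tri T 1 2 (-1) ⊗ₖ tri T 1 2 (-1)) *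
          ((dupPlus T)ᵀ * (dup T)ᵀ * ((triInv T ⊗ₖ triInv T) * dup T))) := by
        simp only [Matrix.mul_assoc]
    _ = dupPlus T * (((tri T 1 2 (-1) * triInv T) ⊗ₖ (tri T 1 2 (-1) * triInv T)) * dup T) := by
        rw [hproj, ← Matrix.mul_assoc (tri T 1 2 (-1) ⊗ₖ tri T 1 2 (-1)),
          ← Matrix.mul_kronecker_mul]
    _ = 1 := by
        rw [tri_mul_triInv, Matrix.one_kronecker_one, Matrix.one_mul, dupPlus_mul_dup]

lemma vechM_dotProduct_MMat_inv {T : ℕ} (X A : Matrix (Fin T) (Fin T) ℝ) (hX : Xᵀ = X)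
    (hA : Aᵀ = A) :
    vechM X ⬝ᵥ ((MMat T)⁻¹ *ᵥ vechM A) = 1 / 2 * (X * (triInv T * A * triInv T)).trace := by
  rw [MMat_inv, Matrix.smul_mulVec, dotProduct_smul, Matrix.mul_assoc, ← Matrix.mulVec_mulVec,
    ← Matrix.mulVec_mulVec, Matrix.dotProduct_mulVec, Matrix.vecMul_transpose,
    dup_mulVec_vechM X hX, dup_mulVec_vechM A hA, Matrix.kronecker_mulVec_vec,
    Matrix.vec_dotProduct_vec, hX, triInv_transpose, smul_eq_mul]

lemma sum_AMat_mul_sub {T : ℕ} (i : Fin T) :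
    ∑ j : Fin T, AMat T i j * ((T : ℝ) - (j : ℕ)) =
      if (i : ℕ) = 0 then ((T : ℝ) - 1) * (1 - 2 * T) / 6 else (T : ℝ) - (i : ℕ) := by
  rw [AMat, sum_tri_mul _ _ _ (fun j => (T : ℝ) - (j : ℝ)) (by simp)]
  split_ifs with h
  · simp only [h]
    push_cast
    ring
  · push_cast [Nat.cast_sub (show 1 ≤ (i : ℕ) by omega)]
    ring

lemma sum_range_sub_sq (n : ℕ) :
    ∑ i ∈ Finset.range n, ((n : ℝ) - i) ^ 2 = n * (n + 1) * (2 * n + 1) / 6 := by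
  induction n with
  | zero => simp
  | succ n ih =>
    rw [Finset.sum_range_succ']
    push_cast
    simp only [add_sub_add_right_eq_sub, ih]
    ring

lemma triInv_mul_AMat_mul_triInv_zero (n : ℕ) :
    (triInv (n + 1) * AMat (n + 1) * triInv (n + 1)) 0 0 = 0 := by
  rw [Matrix.mul_assoc, Matrix.mul_apply]
  have h : ∀ i : Fin (n + 1), (AMat (n + 1) * triInv (n + 1)) i 0 =
      if (i : ℕ) = 0 then (((n + 1 : ℕ) : ℝ) - 1) * (1 - 2 * ((n + 1 : ℕ) : ℝ)) / 6
        else ((n + 1 : ℕ) : ℝ) - (i : ℕ) := by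
    intro i
    rw [← sum_AMat_mul_sub, Matrix.mul_apply]
    simp [triInv]
  simp only [h]
  rw [Fin.sum_univ_succ]
  simp only [triInv, Matrix.of_apply, Fin.val_zero, Fin.val_succ, Nat.zero_max,
    Nat.add_eq_zero_iff, one_ne_zero, and_false, if_false, if_true]
  push_cast
  simp only [add_sub_add_right_eq_sub, ← sq]
  rw [Fin.sum_univ_eq_sum_range (fun i : ℕ => ((n : ℝ) - i) ^ 2), sum_range_sub_sq]
  ring

lemma sum_range_sub (n : ℕ) :
    ∑ i ∈ Finset.range n, ((n : ℝ) - i) = n * (n + 1) / 2 := by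
  induction n with
  | zero => simp
  | succ n ih =>
    rw [Finset.sum_range_succ']
    push_cast
    simp only [add_sub_add_right_eq_sub, ih]
    ring

lemma trace_AMat_mul_triInv (n : ℕ) : (AMat (n + 1) * triInv (n + 1)).trace = 0 := by
  have h : ∀ i : Fin (n + 1), (AMat (n + 1) * triInv (n + 1)) i i =
      if (i : ℕ) = 0 then -(n : ℝ) / 2 * (n + 1) + (n + 2) / 6 * n
        else ((n : ℝ) + 1 - (i : ℕ)) - (n + 2) / 6 := by
    intro i
    have hi := i.isLt
    rw [Matrix.mul_apply]
    simp only [triInv, Matrix.of_apply]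
    rw [AMat, sum_tri_mul _ _ _
      (fun j => ((n + 1 : ℕ) : ℝ) - ((max j (i : ℕ) : ℕ) : ℝ)) (by simp)]
    rw [max_self, max_eq_left (show (i : ℕ) ≤ i + 1 by omega),
      max_eq_right (show (i : ℕ) - 1 ≤ i by omega), max_eq_right (Nat.zero_le _)]
    split_ifs with h0
    · rw [h0]; push_cast; ring
    · push_cast; ring
  simp only [Matrix.trace, Matrix.diag_apply, h]
  rw [Fin.sum_univ_succ]
  simp only [Fin.val_zero, Fin.val_succ, Nat.add_eq_zero_iff, one_ne_zero, and_false, if_false,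
    if_true]
  push_cast
  simp only [add_sub_add_right_eq_sub]
  rw [Finset.sum_sub_distrib, Fin.sum_univ_eq_sum_range (fun i : ℕ => ((n : ℝ) - i)),
    sum_range_sub]
  simp
  ring

lemma AMat_transpose (T : ℕ) : (AMat T)ᵀ = AMat T := tri_isSymm _ _ _ _

lemma ZMat_row_zero (n : ℕ) : ZMat (n + 1) 0 = vechM (Matrix.single 0 0 1) := by
  ext ⟨⟨a, b⟩, h⟩
  simp only [ZMat, vechM, Matrix.single_apply, Matrix.of_apply, Fin.ext_iff, Fin.val_zero,
    if_true]
  exact if_congr (by omega) rfl rfl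

lemma ZMat_row_one (n : ℕ) :
    ZMat (n + 1) 1 = vechM (Matrix.single 0 0 1 - tri (n + 1) 1 2 (-1)) := by
  ext ⟨⟨a, b⟩, h⟩
  simp only [ZMat, vechM, tri, Matrix.single_apply, Matrix.of_apply, Matrix.sub_apply,
    Fin.ext_iff, Fin.val_zero, Fin.val_one] at h ⊢
  split_ifs <;> first | contradiction | omega | norm_num

lemma trace_single_zero_mul {n : ℕ} (B : Matrix (Fin (n + 1)) (Fin (n + 1)) ℝ) :
    (Matrix.single 0 0 1 * B).trace = B 0 0 := by
  simp [Matrix.trace_single_mul]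

lemma ZMat_mul_MMat_inv_mulVec (n : ℕ) (i : Fin 2) :
    ((ZMat (n + 1) * (MMat (n + 1))⁻¹) *ᵥ vechM (AMat (n + 1))) i = 0 := by
  rw [← Matrix.mulVec_mulVec]
  change ZMat (n + 1) i ⬝ᵥ _ = 0
  fin_cases i
  · rw [Fin.zero_eta, ZMat_row_zero, vechM_dotProduct_MMat_inv _ _ (by simp) (AMat_transpose _),
      trace_single_zero_mul, triInv_mul_AMat_mul_triInv_zero, mul_zero]
  · rw [Fin.mk_one, ZMat_row_one, vechM_dotProduct_MMat_inv _ _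
      (by rw [Matrix.transpose_sub, tri_isSymm]; simp) (AMat_transpose _),
      Matrix.sub_mul, Matrix.trace_sub, trace_single_zero_mul, triInv_mul_AMat_mul_triInv_zero,
      ← Matrix.mul_assoc, ← Matrix.mul_assoc, tri_mul_triInv, Matrix.one_mul,
      trace_AMat_mul_triInv, sub_zero, mul_zero]

lemma PMat_mulVec {T : ℕ} (v : VechIdx T → ℝ) (r : RIdx T) (q₁ : VechIdx T)
    (hfst : (q₁.val.1 : ℕ) = 0) (hsnd : (q₁.val.2 : ℕ) = 1) :
    (PMat T *ᵥ v) r = gVec T r * v q₁ + v r.val := by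
  have key : ∀ c : VechIdx T, PMat T r c * v c =
      (if q₁ = c then gVec T r * v c else 0) + (if r.val = c then v c else 0) := by
    intro c
    have e₁ : q₁ = c ↔ (c.val.1 : ℕ) = 0 ∧ (c.val.2 : ℕ) = 1 := by
      rw [Subtype.ext_iff, Prod.ext_iff, Fin.ext_iff, Fin.ext_iff, hfst, hsnd,
        eq_comm (a := 0), eq_comm (a := 1)]
    have hr := r.property
    simp only [PMat, Matrix.of_apply, e₁, eq_comm (a := c)]
    by_cases hrc : r.val = c
    · rw [hrc] at hr
      simp [hrc, hr.1, hr.2]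
    · split_ifs <;> first | omega | simp
  simp only [Matrix.mulVec, dotProduct, key, Finset.sum_add_distrib, Finset.sum_ite_eq,
    Finset.mem_univ, if_true]

/-- P̄_T · vech(A_T) = vech(I_T) − e₁, where P̄_T stacks Z_T·M_T⁻¹ on top
of P_T; the rows of P̄_T are identified with the vech indices by sending the two rows of
Z_T·M_T⁻¹ to the first two vech indices ((0,0) and then (0,1) in (column,row) 0-based
coordinates) and each row of P_T to its own vech index. -/
theorem stmt_3 (T : ℕ) (hT : 2 ≤ T) :
    Matrix.fromRows (ZMat T * (MMat T)⁻¹) (PMat T) *ᵥ vechM (AMat T) =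
      fun s : Fin 2 ⊕ RIdx T =>
        (fun q : VechIdx T =>
            vechM (1 : Matrix (Fin T) (Fin T) ℝ) q -
              (if (q.val.1 : ℕ) = 0 ∧ (q.val.2 : ℕ) = 0 then (1 : ℝ) else 0))
          (Sum.elim
            (fun i : Fin 2 =>
              if (i : ℕ) = 0 then
                (⟨(⟨0, by omega⟩, ⟨0, by omega⟩), Nat.zero_le _⟩ : VechIdx T)
              else ⟨(⟨0, by omega⟩, ⟨1, by omega⟩), Nat.zero_le _⟩)
            Subtype.val s) := by
  ext s
  rw [Matrix.fromRows_mulVec]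
  rcases s with i | r
  · obtain ⟨n, rfl⟩ : ∃ n, T = n + 1 := ⟨T - 1, by omega⟩
    rw [Sum.elim_inl, ZMat_mul_MMat_inv_mulVec]
    fin_cases i <;> simp [vechM, Matrix.one_apply]
  · obtain ⟨⟨⟨a, b⟩, hab⟩, hr⟩ := r
    rw [Sum.elim_inr, PMat_mulVec _ _ ⟨(⟨0, by omega⟩, ⟨1, by omega⟩), Nat.zero_le _⟩ rfl rfl]
    change _ = vechM 1 ⟨(a, b), hab⟩ - if (a : ℕ) = 0 ∧ (b : ℕ) = 0 then (1 : ℝ) else 0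
    simp only [gVec, vechM, AMat, tri, Matrix.of_apply, Matrix.one_apply,
      Fin.ext_iff] at hab hr ⊢
    rw [if_neg hr.1]
    simp only [one_ne_zero, if_false, or_true, if_true]
    split_ifs <;> first | omega | (norm_num; done) | (norm_num; ring)
end
end

section
/- Let T ≥ 2. With G_T = Δ_T(1,2,-1), M_T = 2·D⁺_{u,T}(G_T ⊗ G_T)(D⁺_{u,T})′, p_T = T(T+1)/2 − 2, g_T the p_T-vector defined by vech(G_T) = (1, −1, g_T′)′, P_T = (0 | g_T | I_{p_T}), Z_T the 2 × T(T+1)/2 matrix with rows (1, 0, 0, …, 0) and (0, 1, −g_T′), and P̄_T the T(T+1)/2 × T(T+1)/2 matrix obtained by stacking Z_T·M_T⁻¹ on top of P_T, the matrix P̄_T is invertible. -/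
open Matrix
open scoped Matrix Kronecker

noncomputable section

/-- The lower bidiagonal factor `L` with `L * Lᵀ = tri n 1 2 (-1)`. -/
def bidiag (n : ℕ) : Matrix (Fin n) (Fin n) ℝ :=
  Matrix.of fun i j =>
    if (i : ℕ) = (j : ℕ) then 1 else if (j : ℕ) + 1 = (i : ℕ) then -1 else 0

lemma bidiag_mul_transpose (n : ℕ) : bidiag n * (bidiag n)ᵀ = tri n 1 2 (-1) := by
  ext i j
  have hrow : ∀ f : Fin n → ℝ, ∑ k, bidiag n i k * f k =
      f i - if h : 0 < (i : ℕ) then f ⟨i - 1, by omega⟩ else 0 := by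
    intro f
    have hsplit : ∀ k, bidiag n i k * f k =
        (if k = i then f k else 0) - (if (k : ℕ) + 1 = (i : ℕ) then f k else 0) := by
      intro k
      simp only [bidiag, Matrix.of_apply, Fin.ext_iff]
      split_ifs <;> first | omega | simp
    simp only [hsplit, Finset.sum_sub_distrib, Finset.sum_ite_eq', Finset.mem_univ, if_true]
    congr 1
    split_ifs with h
    · rw [Finset.sum_eq_single (⟨i - 1, by omega⟩ : Fin n)]
      · rw [if_pos (by simp only; omega)]
      · intro k _ hk
        refine if_neg fun hki => hk (Fin.ext ?_)
        simp only
        omega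
      · simp
    · exact Finset.sum_eq_zero fun k _ => if_neg (by omega)
  rw [Matrix.mul_apply]
  simp only [Matrix.transpose_apply]
  rw [hrow]
  simp only [bidiag, tri, Matrix.of_apply]
  split_ifs <;> first | omega | norm_num

lemma det_bidiag (n : ℕ) : (bidiag n).det = 1 := by
  rw [Matrix.det_of_isLowerTriangular]
  · simp [bidiag]
  · intro i j hij
    have hlt : (i : ℕ) < (j : ℕ) := hij
    simp only [bidiag, Matrix.of_apply]
    rw [if_neg (by omega), if_neg (by omega)]

lemma posDef_tri (n : ℕ) : (tri n 1 2 (-1)).PosDef := by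
  rw [← bidiag_mul_transpose, ← Matrix.conjTranspose_eq_transpose_of_trivial]
  refine Matrix.PosDef.mul_conjTranspose_self _ ?_
  refine Matrix.vecMul_injective_of_isUnit ?_
  rw [Matrix.isUnit_iff_isUnit_det, det_bidiag]
  exact isUnit_one

lemma dup_mulVec_apply {T : ℕ} (x : VechIdx T → ℝ) (q : VechIdx T) :
    (dup T *ᵥ x) q.val = x q := by
  rw [Matrix.mulVec, dotProduct, Finset.sum_eq_single q]
  · simp [dup]
  · intro r _ hr
    have hne : ¬ ((q.val.1 = r.val.1 ∧ q.val.2 = r.val.2) ∨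
        (q.val.1 = r.val.2 ∧ q.val.2 = r.val.1)) := by
      intro h
      have h1 := q.2
      have h2 := r.2
      apply hr
      apply Subtype.ext
      apply Prod.ext <;> apply Fin.ext <;> simp only [Fin.ext_iff] at h <;> omega
    simp only [dup, Matrix.of_apply, if_neg hne, zero_mul]
  · simp

/-- A matrix with a right inverse acts injectively on row vectors. -/
lemma vecMul_injective_of_mul_eq_one {m n : Type*} [Fintype m] [Fintype n] [DecidableEq m]
    {A : Matrix m n ℝ} {B : Matrix n m ℝ} (h : A * B = 1) :
    Function.Injective A.vecMul := fun x y hxy => by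
  have := congrArg (fun v => v ᵥ* B) hxy
  simpa [Matrix.vecMul_vecMul, h] using this

lemma posDef_MMat (T : ℕ) : (MMat T).PosDef := by
  refine Matrix.PosDef.smul ?_ two_pos
  rw [← Matrix.conjTranspose_eq_transpose_of_trivial]
  exact ((posDef_tri T).kronecker (posDef_tri T)).mul_mul_conjTranspose_same
    (vecMul_injective_of_mul_eq_one (dupPlus_mul_dup T))

/-- If `P * Zᵀ = 0`, `P * R = 1` and `Zᵀ * W + R * P = 1`, then stacking `Z * K` on top of `P`
gives an invertible matrix as soon as `Z * K * Zᵀ` is invertible. -/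
lemma exists_inverse_fromRows {k r v : Type*} [Fintype k] [Fintype r] [Fintype v]
    [DecidableEq k] [DecidableEq r] [DecidableEq v]
    {Z W : Matrix k v ℝ} {P : Matrix r v ℝ} {R : Matrix v r ℝ} {K : Matrix v v ℝ}
    (hPZ : P * Zᵀ = 0) (hPR : P * R = 1) (hZW : Zᵀ * W + R * P = 1)
    (hN : IsUnit (Z * K * Zᵀ)) :
    ∃ B : Matrix v (k ⊕ r) ℝ,
      Matrix.fromRows (Z * K) P * B = 1 ∧ B * Matrix.fromRows (Z * K) P = 1 := by
  rw [Matrix.isUnit_iff_isUnit_det] at hN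
  set N := Z * K * Zᵀ with hNdef
  have hN1 : N * N⁻¹ = 1 := Matrix.mul_nonsing_inv _ hN
  have hN2 : N⁻¹ * N = 1 := Matrix.nonsing_inv_mul _ hN
  refine ⟨Matrix.fromCols (Zᵀ * N⁻¹) ((1 - Zᵀ * N⁻¹ * (Z * K)) * R), ?_, ?_⟩
  · rw [Matrix.fromRows_mul_fromCols, ← Matrix.fromBlocks_one]
    congr 1
    · rw [← Matrix.mul_assoc, ← hNdef, hN1]
    · rw [← Matrix.mul_assoc, Matrix.mul_sub, ← Matrix.mul_assoc (Z * K) (Zᵀ * N⁻¹),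
        ← Matrix.mul_assoc (Z * K) Zᵀ, ← hNdef, hN1, Matrix.one_mul, Matrix.mul_one,
        sub_self, Matrix.zero_mul]
    · rw [← Matrix.mul_assoc, hPZ, Matrix.zero_mul]
    · rw [← Matrix.mul_assoc, Matrix.mul_sub, ← Matrix.mul_assoc P (Zᵀ * N⁻¹),
        ← Matrix.mul_assoc P Zᵀ, hPZ, Matrix.zero_mul, Matrix.zero_mul, Matrix.mul_one,
        sub_zero, hPR]
  · have hker : (1 - Zᵀ * N⁻¹ * (Z * K)) * Zᵀ = 0 := by
      rw [Matrix.sub_mul, Matrix.one_mul, Matrix.mul_assoc, ← hNdef, Matrix.mul_assoc, hN2,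
        Matrix.mul_one, sub_self]
    rw [Matrix.fromCols_mul_fromRows, Matrix.mul_assoc _ R P, eq_sub_of_add_eq' hZW,
      Matrix.mul_sub, ← Matrix.mul_assoc _ Zᵀ W, hker]
    simp

/-- The position in `vech` of the `(i + 1, 1)` entry of the matrix. -/
def firstColIdx {T : ℕ} (hT : 2 ≤ T) (i : Fin 2) : VechIdx T :=
  ⟨(⟨0, by omega⟩, ⟨i, by omega⟩), by simp⟩

lemma eq_firstColIdx_iff {T : ℕ} (hT : 2 ≤ T) (i : Fin 2) (c : VechIdx T) :
    c = firstColIdx hT i ↔ (c.val.1 : ℕ) = 0 ∧ (c.val.2 : ℕ) = i := by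
  simp [firstColIdx, Subtype.ext_iff, Prod.ext_iff, Fin.ext_iff]

lemma firstColIdx_one_ne_zero {T : ℕ} (hT : 2 ≤ T) :
    firstColIdx hT 1 ≠ firstColIdx hT 0 := by
  simp [firstColIdx]

lemma RIdx.ne_firstColIdx {T : ℕ} (hT : 2 ≤ T) (r : RIdx T) (i : Fin 2) :
    r.val ≠ firstColIdx hT i := by
  rw [Ne, eq_firstColIdx_iff]
  fin_cases i
  · exact r.2.1
  · exact r.2.2

/-- The `vech` positions split into the first two and the remaining ones. -/
lemma VechIdx.cases {T : ℕ} (hT : 2 ≤ T) (c : VechIdx T) :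
    c = firstColIdx hT 0 ∨ c = firstColIdx hT 1 ∨ ∃ r : RIdx T, c = r.val := by
  by_cases h0 : c = firstColIdx hT 0
  · exact Or.inl h0
  by_cases h1 : c = firstColIdx hT 1
  · exact Or.inr (Or.inl h1)
  refine Or.inr (Or.inr ⟨⟨c, ?_, ?_⟩, rfl⟩)
  · simpa [eq_firstColIdx_iff] using h0
  · simpa [eq_firstColIdx_iff] using h1

lemma PMat_apply {T : ℕ} (hT : 2 ≤ T) (r : RIdx T) (c : VechIdx T) :
    PMat T r c =
      (if c = firstColIdx hT 1 then gVec T r else 0) + (if c = r.val then 1 else 0) := by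
  have hr0 := r.ne_firstColIdx hT 0
  have hr1 := r.ne_firstColIdx hT 1
  have h0 := eq_firstColIdx_iff hT 0 c
  have h1 := eq_firstColIdx_iff hT 1 c
  simp only [Fin.val_zero, Fin.val_one] at h0 h1
  simp only [PMat, Matrix.of_apply, ← h0, ← h1]
  rcases VechIdx.cases hT c with rfl | rfl | ⟨s, rfl⟩
  · simp [(firstColIdx_one_ne_zero hT).symm, hr0.symm]
  · simp [firstColIdx_one_ne_zero hT, hr1.symm]
  · simp [s.ne_firstColIdx hT]

lemma ZMat_firstColIdx {T : ℕ} (hT : 2 ≤ T) (i j : Fin 2) :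
    ZMat T i (firstColIdx hT j) = (1 : Matrix (Fin 2) (Fin 2) ℝ) i j := by
  fin_cases i <;> fin_cases j <;> simp [ZMat, firstColIdx]

lemma ZMat_zero_RIdx {T : ℕ} (r : RIdx T) : ZMat T 0 r.val = 0 := by
  simp only [ZMat, Matrix.of_apply, Fin.val_zero, if_true]
  exact if_neg r.2.1

lemma ZMat_one_RIdx {T : ℕ} (r : RIdx T) : ZMat T 1 r.val = -gVec T r := by
  simp only [ZMat, Matrix.of_apply, Fin.val_one, one_ne_zero, if_false, gVec]
  rw [if_neg r.2.1, if_neg r.2.2]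

/-- The selector of the first two entries of a `vech` vector. -/
def headSelector {T : ℕ} (hT : 2 ≤ T) : Matrix (Fin 2) (VechIdx T) ℝ :=
  Matrix.of fun i c => if c = firstColIdx hT i then 1 else 0

/-- The inclusion of the remaining entries into a `vech` vector. -/
def tailInclusion (T : ℕ) : Matrix (VechIdx T) (RIdx T) ℝ :=
  Matrix.of fun c r => if c = r.val then 1 else 0

lemma ZMat_mul_headSelector_transpose {T : ℕ} (hT : 2 ≤ T) :
    ZMat T * (headSelector hT)ᵀ = 1 := by
  ext i j
  simp [Matrix.mul_apply, headSelector, ZMat_firstColIdx]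

lemma PMat_mul_ZMat_transpose {T : ℕ} (hT : 2 ≤ T) : PMat T * (ZMat T)ᵀ = 0 := by
  ext r i
  simp only [Matrix.mul_apply, PMat_apply hT, Matrix.transpose_apply, add_mul, ite_mul,
    zero_mul, one_mul, Finset.sum_add_distrib, Finset.sum_ite_eq', Finset.mem_univ, if_true,
    ZMat_firstColIdx, Matrix.zero_apply]
  match i with
  | 0 => simp [ZMat_zero_RIdx]
  | 1 => simp [ZMat_one_RIdx]

lemma PMat_mul_tailInclusion {T : ℕ} (hT : 2 ≤ T) : PMat T * tailInclusion T = 1 := by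
  ext r s
  simp only [Matrix.mul_apply, tailInclusion, Matrix.of_apply, mul_ite, mul_one, mul_zero,
    Finset.sum_ite_eq', Finset.mem_univ, if_true, PMat_apply hT,
    if_neg (s.ne_firstColIdx hT 1), zero_add, Matrix.one_apply, ← Subtype.ext_iff]
  exact if_congr eq_comm rfl rfl

lemma ZMat_transpose_mul_headSelector_add {T : ℕ} (hT : 2 ≤ T) :
    (ZMat T)ᵀ * headSelector hT + tailInclusion T * PMat T = 1 := by
  ext c d
  simp only [Matrix.add_apply, Matrix.mul_apply, Fin.sum_univ_two, Matrix.transpose_apply,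
    headSelector, tailInclusion, Matrix.of_apply, ite_mul, one_mul, zero_mul]
  rcases VechIdx.cases hT c with rfl | rfl | ⟨r, rfl⟩
  · have hr : ∀ r : RIdx T, firstColIdx hT 0 ≠ r.val := fun r => (r.ne_firstColIdx hT 0).symm
    simp [ZMat_firstColIdx, hr, Matrix.one_apply, eq_comm]
  · have hr : ∀ r : RIdx T, firstColIdx hT 1 ≠ r.val := fun r => (r.ne_firstColIdx hT 1).symm
    simp [ZMat_firstColIdx, hr, Matrix.one_apply, eq_comm]
  · simp only [← Subtype.ext_iff, PMat_apply hT, ZMat_zero_RIdx, ZMat_one_RIdx,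
      Matrix.one_apply, eq_comm (a := r.val)]
    by_cases hd : d = firstColIdx hT 1 <;> simp [hd]

/-- the matrix P̄_T obtained by stacking Z_T·M_T⁻¹ on top of P_T is
invertible (it is square since Fin 2 ⊕ RIdx T has cardinality T(T+1)/2). -/
theorem stmt_9 (T : ℕ) (hT : 2 ≤ T) :
    ∃ B : Matrix (VechIdx T) (Fin 2 ⊕ RIdx T) ℝ,
      Matrix.fromRows (ZMat T * (MMat T)⁻¹) (PMat T) * B = 1 ∧
        B * Matrix.fromRows (ZMat T * (MMat T)⁻¹) (PMat T) = 1 := by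
  refine exists_inverse_fromRows (PMat_mul_ZMat_transpose hT) (PMat_mul_tailInclusion hT)
    (ZMat_transpose_mul_headSelector_add hT) ?_
  rw [← Matrix.conjTranspose_eq_transpose_of_trivial]
  exact ((posDef_MMat T).inv.mul_mul_conjTranspose_same
    (vecMul_injective_of_mul_eq_one (ZMat_mul_headSelector_transpose hT))).isUnit
end
end

section
/- Let T ≥ 2, let P be the (T−1)×(T−1) real matrix with P_{ij} = 1 if i > j and P_{ij} = 0 if i ≤ j (1-based indexing), let ι ∈ ℝ^{T−1} be the vector of ones, and let Q = I_{T−1} − ιι′/(T−1). Then tr(P′QP) = T(T−2)/6. -/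
open Matrix
open scoped Matrix

noncomputable section

/-- the (T−1)×(T−1) strictly lower triangular matrix of ones. -/
def lowOnes (T : ℕ) : Matrix (Fin (T - 1)) (Fin (T - 1)) ℝ :=
  Matrix.of fun i j => if (j : ℕ) < (i : ℕ) then 1 else 0

/-- the all-ones vector in ℝ^{T−1}. -/
def iotaV (T : ℕ) : Fin (T - 1) → ℝ := fun _ => 1

/-- Q = I_{T−1} − ιι′/(T−1), the centering projection matrix. -/
def QMat (T : ℕ) : Matrix (Fin (T - 1)) (Fin (T - 1)) ℝ :=
  1 - ((T : ℝ) - 1)⁻¹ • Matrix.vecMulVec (iotaV T) (iotaV T)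

theorem trace_transpose_mul_one_sub_smul_vecMulVec_mul {m n R : Type*} [Fintype m] [Fintype n]
    [DecidableEq m] [CommRing R] (A : Matrix m n R) (c : R) (u : m → R) :
    Matrix.trace (Aᵀ * (1 - c • Matrix.vecMulVec u u) * A) =
      ∑ j, (∑ i, A i j ^ 2 - c * (∑ i, u i * A i j) ^ 2) := by
  have hvec : Aᵀ * Matrix.vecMulVec u u * A = Matrix.vecMulVec (u ᵥ* A) (u ᵥ* A) := by
    rw [Matrix.mul_vecMulVec, Matrix.vecMulVec_mul, Matrix.mulVec_transpose]
  rw [Matrix.mul_sub, Matrix.sub_mul, Matrix.mul_one, Matrix.mul_smul, Matrix.smul_mul, hvec]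
  simp only [Matrix.trace, Matrix.diag_apply, Matrix.sub_apply, Matrix.smul_apply,
    Matrix.mul_apply, Matrix.transpose_apply, Matrix.vecMulVec_apply, Matrix.vecMul, dotProduct,
    smul_eq_mul, sq]

theorem sum_lowOnes_apply (T : ℕ) (j : Fin (T - 1)) :
    ∑ i, lowOnes T i j = ((T - 1 : ℕ) : ℝ) - 1 - (j : ℕ) := by
  have hcard : ∑ i, lowOnes T i j = ((Finset.Ioi j).card : ℝ) := by
    simp only [lowOnes, Matrix.of_apply, Fin.val_fin_lt, Finset.sum_boole,
      Finset.filter_lt_eq_Ioi]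
  rw [hcard, Fin.card_Ioi, Nat.sub_sub, Nat.cast_sub (by omega)]
  push_cast
  ring

theorem sum_range_mul_sub_sq (n : ℕ) (x : ℝ) :
    ∑ j ∈ Finset.range n, (x * (x - 1 - j) - (x - 1 - j) ^ 2) =
      n * (x - 1) + (x - 2) * (n * (n - 1) / 2) - n * (n - 1) * (2 * n - 1) / 6 := by
  induction n with
  | zero => simp
  | succ k ih =>
    rw [Finset.sum_range_succ, ih]
    push_cast
    ring

/-- tr(P′QP) = T(T−2)/6. -/
theorem stmt_10 (T : ℕ) (hT : 2 ≤ T) :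
    Matrix.trace ((lowOnes T)ᵀ * QMat T * lowOnes T) = (T : ℝ) * ((T : ℝ) - 2) / 6 := by
  have hn : ((T - 1 : ℕ) : ℝ) = (T : ℝ) - 1 := by
    rw [Nat.cast_sub (by omega), Nat.cast_one]
  have hpos : (T : ℝ) - 1 ≠ 0 := by
    have : (2 : ℝ) ≤ T := by exact_mod_cast hT
    linarith
  have hsq (i j : Fin (T - 1)) : lowOnes T i j ^ 2 = lowOnes T i j := by
    simp [lowOnes]
  rw [QMat, trace_transpose_mul_one_sub_smul_vecMulVec_mul]
  simp only [iotaV, one_mul, hsq, sum_lowOnes_apply, hn]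
  rw [Fin.sum_univ_eq_sum_range
    (fun j : ℕ => (T : ℝ) - 1 - 1 - j - ((T : ℝ) - 1)⁻¹ * ((T : ℝ) - 1 - 1 - j) ^ 2)]
  have hterm (j : ℕ) : (T : ℝ) - 1 - 1 - j - ((T : ℝ) - 1)⁻¹ * ((T : ℝ) - 1 - 1 - j) ^ 2 =
      ((T : ℝ) - 1)⁻¹ *
        (((T : ℝ) - 1) * ((T : ℝ) - 1 - 1 - j) - ((T : ℝ) - 1 - 1 - j) ^ 2) := by
    field_simp
  simp only [hterm]
  rw [← Finset.mul_sum, sum_range_mul_sub_sq, hn]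
  field_simp
  ring
end
end

section
/- Let T ≥ 2 and let P be the (T−1)×(T−1) real matrix with P_{ij} = 1 if i > j and P_{ij} = 0 if i ≤ j (1-based indexing). Then tr(P′PP′P) = (T−2)(T−1)(T²−3T+3)/6. -/
open Matrix
open scoped Matrix

noncomputable section

/-- The Gram matrix of the rows of `lowOnes T` has entries `min i j` (indices from `0`). -/
theorem lowOnes_mul_transpose_apply (T : ℕ) (i j : Fin (T - 1)) :
    (lowOnes T * (lowOnes T)ᵀ) i j = (min (i : ℕ) (j : ℕ) : ℕ) := by
  simp only [lowOnes, mul_apply, transpose_apply, of_apply, ← ite_and, mul_ite, mul_one, mul_zero]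
  rw [Fin.sum_univ_eq_sum_range (fun k => if k < (j : ℕ) ∧ k < (i : ℕ) then (1 : ℝ) else 0),
    Finset.sum_boole]
  have h : {k ∈ Finset.range (T - 1) | k < (j : ℕ) ∧ k < (i : ℕ)} =
      Finset.range (min (i : ℕ) (j : ℕ)) := by
    ext k
    simp only [Finset.mem_filter, Finset.mem_range]
    omega
  rw [h, Finset.card_range]

theorem sum_range_natCast_sq (n : ℕ) :
    ∑ i ∈ Finset.range n, (i : ℝ) ^ 2 = (n - 1) * n * (2 * n - 1) / 6 := by
  induction n with
  | zero => simp
  | succ n ih =>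
    rw [Finset.sum_range_succ, ih]
    push_cast
    ring

theorem sum_range_sum_range_min_sq (n : ℕ) :
    ∑ i ∈ Finset.range n, ∑ j ∈ Finset.range n, ((min i j : ℕ) : ℝ) ^ 2 =
      ((n : ℝ) - 1) * n * ((n : ℝ) ^ 2 - n + 1) / 6 := by
  induction n with
  | zero => simp
  | succ n ih =>
    have hcol : ∑ i ∈ Finset.range n, ((min i n : ℕ) : ℝ) ^ 2 =
        ∑ i ∈ Finset.range n, (i : ℝ) ^ 2 :=
      Finset.sum_congr rfl fun i hi => by rw [min_eq_left (Finset.mem_range.mp hi).le]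
    have hrow : ∑ j ∈ Finset.range n, ((min n j : ℕ) : ℝ) ^ 2 =
        ∑ j ∈ Finset.range n, (j : ℝ) ^ 2 :=
      Finset.sum_congr rfl fun j hj => by rw [min_eq_right (Finset.mem_range.mp hj).le]
    simp only [Finset.sum_range_succ, Finset.sum_add_distrib]
    rw [ih, hcol, hrow, sum_range_natCast_sq, min_self]
    push_cast
    ring

/-- tr(P′PP′P) = (T−2)(T−1)(T²−3T+3)/6. -/
theorem stmt_14 (T : ℕ) (hT : 2 ≤ T) :
    Matrix.trace ((lowOnes T)ᵀ * lowOnes T * (lowOnes T)ᵀ * lowOnes T) =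
      ((T : ℝ) - 2) * ((T : ℝ) - 1) * ((T : ℝ) ^ 2 - 3 * (T : ℝ) + 3) / 6 := by
  have htrace : Matrix.trace ((lowOnes T)ᵀ * lowOnes T * (lowOnes T)ᵀ * lowOnes T) =
      ∑ i : Fin (T - 1), ∑ j : Fin (T - 1), ((min (i : ℕ) (j : ℕ) : ℕ) : ℝ) ^ 2 := by
    rw [Matrix.trace_mul_comm, Matrix.mul_assoc, ← Matrix.mul_assoc, trace]
    refine Finset.sum_congr rfl fun i _ => ?_
    rw [diag_apply, mul_apply]
    refine Finset.sum_congr rfl fun j _ => ?_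
    rw [lowOnes_mul_transpose_apply, lowOnes_mul_transpose_apply, min_comm (j : ℕ), sq]
  have hcast : ((T - 1 : ℕ) : ℝ) = T - 1 := by
    rw [Nat.cast_sub (by omega), Nat.cast_one]
  rw [htrace, Finset.sum_congr rfl fun (i : Fin (T - 1)) _ =>
      Fin.sum_univ_eq_sum_range (fun j => ((min (i : ℕ) j : ℕ) : ℝ) ^ 2) (T - 1),
    Fin.sum_univ_eq_sum_range
      (fun i => ∑ j ∈ Finset.range (T - 1), ((min i j : ℕ) : ℝ) ^ 2) (T - 1),
    sum_range_sum_range_min_sq, hcast]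
  ring
end
end

section
/- Let T ≥ 2, let P be the (T−1)×(T−1) real matrix with P_{ij} = 1 if i > j and P_{ij} = 0 if i ≤ j (1-based indexing), let ι ∈ ℝ^{T−1} be the vector of ones, and let Q = I_{T−1} − ιι′/(T−1). Then tr(QPQP) = −(T−2)(T−6)/12. -/
open Matrix
open scoped Matrix

noncomputable section

/-- The trace of `(MA)²` for the rank-one perturbation `M = 1 - c • uu′` of the identity. -/
theorem trace_one_sub_smul_vecMulVec_mul_sq {n R : Type*} [Fintype n] [DecidableEq n] [CommRing R]
    (A : Matrix n n R) (u : n → R) (c : R) :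
    trace ((1 - c • vecMulVec u u) * A * (1 - c • vecMulVec u u) * A) =
      trace (A * A) - 2 * c * ((u ᵥ* A) ⬝ᵥ (A *ᵥ u)) + c ^ 2 * (u ⬝ᵥ (A *ᵥ u)) ^ 2 := by
  have h₁ : trace (vecMulVec u u * A * A) = (u ᵥ* A) ⬝ᵥ (A *ᵥ u) := by
    rw [vecMulVec_mul, vecMulVec_mul, trace_vecMulVec, dotProduct_comm, dotProduct_mulVec]
  have h₂ : trace (A * vecMulVec u u * A) = (u ᵥ* A) ⬝ᵥ (A *ᵥ u) := by
    rw [mul_vecMulVec, vecMulVec_mul, trace_vecMulVec, dotProduct_comm]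
  have h₃ : trace (vecMulVec u u * A * vecMulVec u u * A) = (u ⬝ᵥ (A *ᵥ u)) ^ 2 := by
    rw [vecMulVec_mul, vecMulVec_mul_vecMulVec, vecMulVec_mul, trace_vecMulVec, smul_vecMul,
      dotProduct_smul, smul_eq_mul, dotProduct_comm u (u ᵥ* A), ← dotProduct_mulVec, sq]
  simp only [sub_mul, mul_sub, one_mul, mul_one, smul_mul_assoc, mul_smul_comm, trace_sub,
    trace_smul, smul_eq_mul, h₁, h₂, h₃]
  ring

/-- The row sums of the strictly lower triangular matrix of ones. -/
theorem lowOnes_mulVec_iotaV (T : ℕ) (i : Fin (T - 1)) : (lowOnes T *ᵥ iotaV T) i = (i : ℝ) := by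
  have h : (Finset.univ.filter fun j : Fin (T - 1) => j < i) = Finset.Iio i := by
    ext j; simp
  simp [lowOnes, iotaV, mulVec, dotProduct, h]

/-- The column sums of the strictly lower triangular matrix of ones. -/
theorem iotaV_vecMul_lowOnes (T : ℕ) (hT : 2 ≤ T) (j : Fin (T - 1)) :
    (iotaV T ᵥ* lowOnes T) j = (T : ℝ) - 2 - j := by
  have h : (Finset.univ.filter fun i : Fin (T - 1) => j < i) = Finset.Ioi j := by
    ext i; simp
  have hc : ((T - 1 - 1 - j : ℕ) : ℝ) = (T : ℝ) - 2 - j := by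
    rw [eq_sub_iff_add_eq, eq_sub_iff_add_eq]
    have hj := j.isLt
    norm_cast
    omega
  simpa [lowOnes, iotaV, vecMul, dotProduct, h] using hc

theorem trace_lowOnes_mul_lowOnes (T : ℕ) : trace (lowOnes T * lowOnes T) = 0 := by
  refine Finset.sum_eq_zero fun i _ => ?_
  rw [diag_apply, mul_apply]
  refine Finset.sum_eq_zero fun j _ => ?_
  simpa [lowOnes] using fun h : i < j => h.le

theorem sum_range_cast (n : ℕ) : ∑ k ∈ Finset.range n, (k : ℝ) = n * (n - 1) / 2 := by
  induction n with
  | zero => simp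
  | succ n ih => rw [Finset.sum_range_succ, ih]; push_cast; ring

theorem sum_range_cast_sq (n : ℕ) :
    ∑ k ∈ Finset.range n, (k : ℝ) ^ 2 = n * (n - 1) * (2 * n - 1) / 6 := by
  induction n with
  | zero => simp
  | succ n ih => rw [Finset.sum_range_succ, ih]; push_cast; ring

/-- tr(QPQP) = −(T−2)(T−6)/12. -/
theorem stmt_15 (T : ℕ) (hT : 2 ≤ T) :
    Matrix.trace (QMat T * lowOnes T * QMat T * lowOnes T) =
      -(((T : ℝ) - 2) * ((T : ℝ) - 6) / 12) := by
  have hcast : ((T - 1 : ℕ) : ℝ) = (T : ℝ) - 1 := by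
    rw [Nat.cast_sub (by omega), Nat.cast_one]
  have hne : (T : ℝ) - 1 ≠ 0 := by
    rw [← hcast, Nat.cast_ne_zero]
    omega
  have hsum : iotaV T ⬝ᵥ (lowOnes T *ᵥ iotaV T) = ((T : ℝ) - 1) * (T - 2) / 2 := by
    simp only [dotProduct, lowOnes_mulVec_iotaV]
    simp only [iotaV, one_mul]
    rw [Fin.sum_univ_eq_sum_range (fun k => (k : ℝ)), sum_range_cast, hcast]
    ring
  have hdot : (iotaV T ᵥ* lowOnes T) ⬝ᵥ (lowOnes T *ᵥ iotaV T) =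
      ((T : ℝ) - 1) * (T - 2) * (T - 3) / 6 := by
    simp only [dotProduct, lowOnes_mulVec_iotaV, iotaV_vecMul_lowOnes T hT]
    rw [Fin.sum_univ_eq_sum_range (fun k => ((T : ℝ) - 2 - k) * k)]
    simp only [sub_mul _ (Nat.cast _ : ℝ), ← sq, Finset.sum_sub_distrib, ← Finset.mul_sum]
    rw [sum_range_cast, sum_range_cast_sq, hcast]
    ring
  rw [QMat, trace_one_sub_smul_vecMulVec_mul_sq, trace_lowOnes_mul_lowOnes, hsum, hdot]
  field_simp
  ring
end
end
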